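/- arXiv:1903.08441 — 2 statements merged into one kernel-verified Lean document; each statement's English description precedes it below -/
import Mathlib

section
/- Let K be a field and a(x), b(x) ∈ K[x₁,...,xₙ] with gcd(a, b) = 1. Then for every n-tuple h₁(x₁),...,hₙ(xₙ) of non-constant univariate polynomials over K, gcd(a(h₁(x₁),...,hₙ(xₙ)), b(h₁(x₁),...,hₙ(xₙ))) = 1. -/
/-- The substitution `xᵢ ↦ hᵢ(xᵢ)` on multivariate polynomials. -/
noncomputable def substVars {K : Type*} [Field K] {n : ℕ} (h : Fin n → Polynomial K) :
    MvPolynomial (Fin n) K →+* MvPolynomial (Fin n) K :=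
  (MvPolynomial.aeval fun i => Polynomial.aeval (MvPolynomial.X i) (h i)).toRingHom

theorem relPrime_of_integral {R S : Type*} [CommRing R] [IsDomain R] [UniqueFactorizationMonoid R]
    [CommRing S] [IsDomain S] [UniqueFactorizationMonoid S] [Algebra R S] [FaithfulSMul R S]
    [Algebra.IsIntegral R S] (a b : R) (hab : IsRelPrime a b) (ha : a ≠ 0) :
    IsRelPrime (algebraMap R S a) (algebraMap R S b) := by
  have hinj : Function.Injective (algebraMap R S) := FaithfulSMul.algebraMap_injective R S
  have ha' : algebraMap R S a ≠ 0 := by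
    rw [Ne, map_eq_zero_iff _ hinj]; exact ha
  refine UniqueFactorizationMonoid.isRelPrime_iff_no_prime_factors ha' |>.2 ?_
  intro d hda hdb hd
  have hdp : (Ideal.span {d}).IsPrime := (Ideal.span_singleton_prime hd.ne_zero).2 hd
  set P : Ideal R := (Ideal.span {d}).under R with hP
  have haP : a ∈ P := by
    rw [hP, Ideal.mem_comap]; exact Ideal.mem_span_singleton.2 hda
  -- a prime factor of a in P
  obtain ⟨q, hqP, hqa, hq⟩ : ∃ q ∈ P, q ∣ a ∧ Prime q := by
    have hPp : P.IsPrime := inferInstance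
    have := (UniqueFactorizationMonoid.factors_prod ha)
    have h2 : (UniqueFactorizationMonoid.factors a).prod ∈ P := by
      obtain ⟨u, hu⟩ := this.symm
      rw [← hu]; exact P.mul_mem_right _ haP
    obtain ⟨q, hq, hqP⟩ := (Ideal.IsPrime.multiset_prod_mem_iff_exists_mem hPp _).1 h2
    exact ⟨q, hqP, UniqueFactorizationMonoid.dvd_of_mem_factors hq,
      UniqueFactorizationMonoid.prime_of_factor q hq⟩
  have hqp : (Ideal.span {q}).IsPrime := (Ideal.span_singleton_prime hq.ne_zero).2 hq
  have hle : Ideal.span {q} ≤ P := (Ideal.span_singleton_le_iff_mem _).2 hqP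
  have : (Ideal.span {d}).LiesOver P := ⟨rfl⟩
  obtain ⟨Q, hQ, hQp, hQq⟩ :=
    (Ideal.span {d}).exists_ideal_le_liesOver_of_le (p := Ideal.span {q}) (q := P) hle
  have hmem : ∀ x : R, x ∈ Ideal.span {q} ↔ algebraMap R S x ∈ Q := by
    intro x
    rw [hQq.over, Ideal.mem_comap]
  have hQ0 : Q ≠ ⊥ := by
    rintro rfl
    have := (hmem q).1 (Ideal.mem_span_singleton_self q)
    rw [Ideal.mem_bot, map_eq_zero_iff _ hinj] at this
    exact hq.ne_zero this
  obtain ⟨e, heQ, he⟩ := Ideal.IsPrime.exists_mem_prime_of_ne_bot hQp hQ0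
  have hde : d ∣ e := Ideal.mem_span_singleton.1 (hQ heQ)
  have hed : e ∣ d := (hd.associated_of_dvd he hde).symm.dvd
  have hbQ : algebraMap R S b ∈ Q := Q.mem_of_dvd (hed.trans hdb) heQ
  have hqb : q ∣ b := Ideal.mem_span_singleton.1 ((hmem b).2 hbQ)
  exact hq.not_isUnit (hab hqa hqb)

theorem substVars_injective {K : Type*} [Field K] {n : ℕ}
    (h : Fin n → Polynomial K) (hh : ∀ i, 0 < (h i).natDegree) :
    Function.Injective (substVars h) := by
  have := (MvPolynomial.algebraicIndependent_X (Fin n) K).polynomial_aeval_of_transcendental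
    (f := h) (fun i => (h i).transcendental (hh i).ne' (by
      rw [mem_nonZeroDivisors_iff_ne_zero, Ne, Polynomial.leadingCoeff_eq_zero]
      intro h0
      have := hh i
      simp [h0] at this))
  exact this

theorem substVars_isIntegral {K : Type*} [Field K] {n : ℕ}
    (h : Fin n → Polynomial K) (hh : ∀ i, 0 < (h i).natDegree) :
    (substVars h).IsIntegral := by
  have hC : ∀ c : K, substVars h (MvPolynomial.C c) = MvPolynomial.C c := by
    intro c
    simp [substVars, MvPolynomial.algebraMap_eq]
  have hX : ∀ i, substVars h (MvPolynomial.X i) =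
      Polynomial.aeval (MvPolynomial.X i) (h i) := by
    intro i
    simp [substVars]
  intro x
  induction x using MvPolynomial.induction_on with
  | C c =>
    have := (substVars h).isIntegralElem_map (x := MvPolynomial.C c)
    rwa [hC] at this
  | add p q hp hq => exact hp.add _ hq
  | mul_X p i hp =>
    refine hp.mul _ ?_
    have h0 : h i ≠ 0 := by
      intro h0
      have := hh i
      simp [h0] at this
    letI := (substVars h).toAlgebra
    change IsIntegral (MvPolynomial (Fin n) K) (MvPolynomial.X i : MvPolynomial (Fin n) K)
    have hm : (h i * Polynomial.C (h i).leadingCoeff⁻¹).Monic :=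
      Polynomial.monic_mul_leadingCoeff_inv h0
    refine IsIntegral.of_aeval_monic
      (p := (h i * Polynomial.C (h i).leadingCoeff⁻¹).map MvPolynomial.C) (hm.map _) ?_ ?_
    · rw [hm.natDegree_map, Polynomial.natDegree_mul_leadingCoeff_inv _ h0]
      exact (hh i).ne'
    · have e : Polynomial.aeval (MvPolynomial.X i : MvPolynomial (Fin n) K)
          ((h i * Polynomial.C (h i).leadingCoeff⁻¹).map
            (MvPolynomial.C : K →+* MvPolynomial (Fin n) K)) =
          substVars h (MvPolynomial.X i * MvPolynomial.C (h i).leadingCoeff⁻¹) := by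
        rw [map_mul, hX, hC, Polynomial.aeval_def, Polynomial.eval₂_map]
        have : (algebraMap (MvPolynomial (Fin n) K) (MvPolynomial (Fin n) K)).comp
            MvPolynomial.C = (MvPolynomial.C : K →+* MvPolynomial (Fin n) K) := by
          ext1 c
          exact hC c
        rw [this, Polynomial.eval₂_mul, Polynomial.eval₂_C]
        rfl
      rw [e]
      exact (substVars h).isIntegralElem_map

/-- If `gcd(a,b) = 1` then the substitutions `a(h₁(x₁),…,hₙ(xₙ))` and
`b(h₁(x₁),…,hₙ(xₙ))` by non-constant univariate polynomials are still coprime. -/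
theorem stmt1 {K : Type*} [Field K] {n : ℕ}
    (a b : MvPolynomial (Fin n) K) (hab : IsRelPrime a b)
    (h : Fin n → Polynomial K) (hh : ∀ i, 0 < (h i).natDegree) :
    IsRelPrime (substVars h a) (substVars h b) := by
  by_cases ha : a = 0
  · subst ha
    exact ((isRelPrime_zero_left.1 hab).map (substVars h)).isRelPrime_right
  · have hi := substVars_injective h hh
    have hint := substVars_isIntegral h hh
    generalize substVars h = f at *
    let R := MvPolynomial (Fin n) K
    exact @relPrime_of_integral R R _ _ _ _ _ _ f.toAlgebra
      ((@faithfulSMul_iff_algebraMap_injective R R _ _ f.toAlgebra).2 hi)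
      (@Algebra.IsIntegral.mk R R _ _ f.toAlgebra hint) a b hab ha
end

section
/- Let K be a field of characteristic p > 0, f₁(t), f₂(t) ∈ K[t] distinct polynomials of positive degrees d₁ and d₂ with p ∤ (d₁ − d₂), and r ∈ K with r ≠ 0. Then F(x,y) = f₁(x)f₂(y) − f₂(x)f₁(y) + r is absolutely irreducible. -/
open Polynomial

section aux
variable {L : Type*} [Field L]

noncomputable def phi (L : Type*) [Field L] : L[X][X] →+* L[X][X] :=
  eval₂RingHom (mapRingHom (C : L →+* L[X])) (C X * X)

lemma phi_C (f : L[X]) : phi L (C f) = f.map C := by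
  simp [phi]

lemma phi_map (f : L[X]) : phi L (f.map C) = (f.map C).comp (C X * X) := by
  simp only [phi, coe_eval₂RingHom, eval₂_map, comp]
  congr 1
  ext a : 1
  simp

lemma phi_inj : Function.Injective (phi L) := by
  have h : phi L = ((Polynomial.Bivariate.swap (R := L)).toRingEquiv.toRingHom).comp
      (compRingHom (C X * X)) := by
    apply Polynomial.ringHom_ext'
    · apply Polynomial.ringHom_ext'
      · ext a : 1
        simp [phi, Bivariate.swap_C_C]
      · simp [phi, Bivariate.swap_X]
    · simp [phi, Bivariate.swap_X, Bivariate.swap_Y]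
  rw [h, RingHom.coe_comp]
  refine Function.Injective.comp (Polynomial.Bivariate.swap (R := L)).injective ?_
  rw [injective_iff_map_eq_zero]
  intro P hP
  ext1 n
  have := congrArg (fun q => q.coeff n) hP
  simpa [comp_C_mul_X_coeff] using this

lemma phi_const (G : L[X][X]) (h : (phi L G).natDegree = 0) : ∃ g : L, G = C (C g) := by
  refine ⟨(G.eval 0).eval 0, ?_⟩
  apply phi_inj
  have e : ((evalRingHom (0 : L[X])).comp (phi L)) =
      (C : L →+* L[X]).comp ((evalRingHom (0:L)).comp (evalRingHom (0:L[X]))) := by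
    apply Polynomial.ringHom_ext'
    · apply Polynomial.ringHom_ext'
      · ext a : 1
        simp [phi]
      · simp [phi]
    · simp [phi]
  have e2 := congrArg (fun q => q G) e
  simp only [RingHom.comp_apply, coe_evalRingHom] at e2
  rw [phi_C, map_C, ← e2]
  rw [← coeff_zero_eq_eval_zero]
  exact eq_C_of_natDegree_eq_zero h

lemma key (f₁ f₂ : L[X]) (hm : (f₁.natDegree : L) ≠ f₂.natDegree) (h0 : 0 < f₁.natDegree)
    (h0' : 0 < f₂.natDegree)
    (r : L) (hr : r ≠ 0) :
    Irreducible (C f₁ * (f₂.map C) - C f₂ * (f₁.map C) + C (C r)) := by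
  set F := C f₁ * (f₂.map C) - C f₂ * (f₁.map C) + C (C r) with hF
  set d₁ := f₁.natDegree with hd₁
  set d₂ := f₂.natDegree with hd₂
  have h1 : f₁ ≠ 0 := by rintro rfl; simp at hd₁; omega
  have h2 : f₂ ≠ 0 := by rintro rfl; simp at hd₂; omega
  have dm : ∀ f : L[X], (f.map (C : L →+* L[X])).natDegree ≤ f.natDegree := fun f => natDegree_map_le
  have dc : ∀ f : L[X], ((f.map (C : L →+* L[X])).comp (C X * X)).natDegree ≤ f.natDegree := by
    intro f
    refine natDegree_comp_le.trans ?_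
    have : (C (X : L[X]) * X).natDegree ≤ 1 := (natDegree_C_mul_X _ X_ne_zero).le
    calc _ ≤ f.natDegree * 1 := Nat.mul_le_mul (dm f) this
      _ = _ := mul_one _
  have pF : phi L F = f₁.map C * (f₂.map C).comp (C X * X) - f₂.map C * (f₁.map C).comp (C X * X)
      + C (C r) := by
    rw [hF, map_add, map_sub, map_mul, map_mul, phi_map, phi_map, phi_C, phi_C, phi_C, map_C]
  set T : L[X] := C (f₁.leadingCoeff * f₂.leadingCoeff) * (X ^ d₂ - X ^ d₁) with hT
  have cF : (phi L F).coeff (d₁ + d₂) = T := by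
    rw [pF, coeff_add, coeff_sub, coeff_mul_add_eq_of_natDegree_le (dm f₁) (dc f₂), add_comm d₁ d₂,
      coeff_mul_add_eq_of_natDegree_le (dm f₂) (dc f₁), coeff_C_ne_zero (by omega)]
    simp only [comp_C_mul_X_coeff, coeff_map, coeff_natDegree, hT, C_mul, hd₁, hd₂]
    ring
  have dF : (phi L F).natDegree ≤ d₁ + d₂ := by
    rw [pF]
    refine natDegree_add_le_of_degree_le ((natDegree_sub_le_of_le (m := d₁ + d₂) (n := d₁ + d₂) ?_ ?_).trans_eq (max_self _)) (by simp)
    · exact natDegree_mul_le_of_le (dm f₁) (dc f₂)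
    · rw [add_comm]; exact natDegree_mul_le_of_le (dm f₂) (dc f₁)
  have dT : (derivative T).eval 1 ≠ 0 := by
    have : (derivative T).eval 1 = f₁.leadingCoeff * f₂.leadingCoeff * ((d₂ : L) - d₁) := by
      simp [hT, derivative_X_pow]
    rw [this]
    exact mul_ne_zero (mul_ne_zero (by simpa using h1) (by simpa using h2))
      (sub_ne_zero.2 (Ne.symm hm))
  have T0 : T ≠ 0 := by intro h; simp [h] at dT
  have nF : (phi L F).natDegree = d₁ + d₂ := natDegree_eq_of_le_of_coeff_ne_zero dF (cF ▸ T0)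
  have lF : (phi L F).leadingCoeff = T := by rw [leadingCoeff, nF, cF]
  have sF : (phi L F).map (evalRingHom (1 : L)) = C r := by
    have hc : (evalRingHom (1 : L)).comp C = RingHom.id L := by ext; simp
    rw [pF]
    simp [Polynomial.map_comp, Polynomial.map_map, hc]
    ring
  have F0 : F ≠ 0 := by
    intro h; rw [h] at lF; simp at lF; exact T0 lF.symm
  have van : ∀ G : L[X][X], IsUnit ((phi L G).map (evalRingHom (1 : L))) →
      (phi L G).natDegree ≠ 0 → (phi L G).leadingCoeff.eval 1 = 0 := by
    intro G hu hn
    have := natDegree_eq_zero_of_isUnit hu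
    have h3 : ((phi L G).map (evalRingHom (1 : L))).coeff (phi L G).natDegree = 0 :=
      coeff_eq_zero_of_natDegree_lt (by omega)
    simpa [coeff_map] using h3
  constructor
  · intro hu
    obtain ⟨u, hu1, hu2⟩ := isUnit_iff.1 hu
    obtain ⟨v, hv1, hv2⟩ := isUnit_iff.1 hu1
    rw [← hu2, ← hv2, phi_C, map_C, natDegree_C] at nF
    omega
  · intro G H hGH
    have uc : IsUnit ((phi L G).map (evalRingHom (1 : L)) * (phi L H).map (evalRingHom (1 : L))) := by
      rw [← Polynomial.map_mul, ← map_mul, ← hGH, sF]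
      exact isUnit_C.2 hr.isUnit
    have fin : ∀ G : L[X][X], G ≠ 0 → (phi L G).natDegree = 0 → IsUnit G := by
      intro G hG hn
      obtain ⟨g, rfl⟩ := phi_const G hn
      exact isUnit_C.2 (isUnit_C.2 (isUnit_iff_ne_zero.2 (by rintro rfl; simp at hG)))
    by_contra hcon
    push Not at hcon
    have vG := van G (isUnit_of_mul_isUnit_left uc)
      (fun h => hcon.1 (fin G (by rintro rfl; simp at hGH; exact F0 hGH) h))
    have vH := van H (isUnit_of_mul_isUnit_right uc)
      (fun h => hcon.2 (fin H (by rintro rfl; simp at hGH; exact F0 hGH) h))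
    apply dT
    rw [← lF, hGH, map_mul, leadingCoeff_mul]
    simp [derivative_mul, vG, vH]
end aux

/-- Theorem 3.3 (positive characteristic case): if `char K = p > 0`,
`f₁, f₂ ∈ K[t]` are distinct of positive degrees `d₁, d₂` with `p ∤ d₁ - d₂`,
and `r ≠ 0`, then `F(x,y) = f₁(x)f₂(y) - f₂(x)f₁(y) + r` is absolutely irreducible. -/
theorem stmt12 {K : Type*} [Field K] (p : ℕ) (hp : 0 < p) [CharP K p]
    (f₁ f₂ : Polynomial K) (hne : f₁ ≠ f₂)
    (hd₁ : 0 < f₁.natDegree) (hd₂ : 0 < f₂.natDegree)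
    (hdvd : ¬ (p : ℤ) ∣ ((f₁.natDegree : ℤ) - (f₂.natDegree : ℤ)))
    (r : K) (hr : r ≠ 0) :
    Irreducible ((Polynomial.C f₁ * (f₂.map Polynomial.C) -
        Polynomial.C f₂ * (f₁.map Polynomial.C) +
        Polynomial.C (Polynomial.C r)).map
      (Polynomial.mapRingHom (algebraMap K (AlgebraicClosure K)))) := by
  set i := algebraMap K (AlgebraicClosure K)
  have hK : (f₁.natDegree : K) ≠ f₂.natDegree := by
    intro h
    apply hdvd
    rw [← CharP.intCast_eq_zero_iff K p]
    push_cast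
    rw [h, sub_self]
  have hL : ((f₁.map i).natDegree : AlgebraicClosure K) ≠ (f₂.map i).natDegree := by
    rw [natDegree_map, natDegree_map]
    intro h
    apply hK
    apply i.injective
    simpa using h
  have := key (f₁.map i) (f₂.map i) hL (by rwa [natDegree_map]) (by rwa [natDegree_map])
    (i r) (by simpa using hr)
  have hc : (mapRingHom i).comp C = C.comp i := by ext1; simp
  convert this using 1
  simp [Polynomial.map_map, hc]
end
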